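/- The constant 16/9 is sharp at radius 1/3: inf_{0 ≤ a < 1} (16/9)·(9−a⁴)/((1+a)²(3−a)) = 16/9, i.e. the sharp constant Λ_{φ₀}(1/3) for the function φ₀(f,r) := S_r(f)/(π − S_r(f)) equals 16/9. -/

import Mathlib

open Metric

/-- The `n`-th Taylor coefficient of `f` at `0`. -/
noncomputable def taylorCoeff (f : ℂ → ℂ) (n : ℕ) : ℂ :=
  iteratedDeriv n f 0 / n.factorial

/-- The class `𝓑` of holomorphic functions on the unit disc bounded by `1`. -/
def memB (f : ℂ → ℂ) : Prop :=
  DifferentiableOn ℂ f (ball (0 : ℂ) 1) ∧ ∀ z ∈ ball (0 : ℂ) 1, ‖f z‖ ≤ 1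

/-- `Σ_{n≥0} |aₙ| rⁿ`, the Bohr sum of `f` at radius `r`. -/
noncomputable def bohrSum (f : ℂ → ℂ) (r : ℝ) : ℝ :=
  ∑' n : ℕ, ‖taylorCoeff f n‖ * r ^ n

/-- `S_r(f) = π Σ_{n≥1} n |aₙ|² r^{2n}` (the `n = 0` term vanishes, so we may sum over
all of `ℕ`). -/
noncomputable def Sarea (f : ℂ → ℂ) (r : ℝ) : ℝ :=
  Real.pi * ∑' n : ℕ, (n : ℝ) * ‖taylorCoeff f n‖ ^ 2 * r ^ (2 * n)

/-- `φ₀(f,r) = S_r(f)/(π − S_r(f))`. -/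
noncomputable def phi0 (f : ℂ → ℂ) (r : ℝ) : ℝ :=
  Sarea f r / (Real.pi - Sarea f r)

/-- The sharp constant `Λ_φ(R)`. -/
noncomputable def sharpConstant (φ : (ℂ → ℂ) → ℝ → ℝ) (R : ℝ) : ℝ :=
  sSup {l : ℝ | 0 ≤ l ∧
    ∀ f, memB f → ∀ r, 0 ≤ r → r ≤ R → bohrSum f r + l * φ f r ≤ 1}


open AddCircle in
/-- Parseval for absolutely convergent one-sided series. -/
theorem parseval_aux (c : ℕ → ℂ) (hc : Summable fun n => ‖c n‖) :
    ∃ G : C(AddCircle (1:ℝ), ℂ), (∀ x, HasSum (fun n => c n * (toCircle x : ℂ) ^ n) (G x)) ∧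
      HasSum (fun n => ‖c n‖ ^ 2)
        (‖ContinuousMap.toLp (E := ℂ) 2 (haarAddCircle (T := (1:ℝ))) ℂ G‖ ^ 2) := by
  have hs : Summable (fun n : ℕ => c n • fourier (T := (1:ℝ)) (n : ℤ)) := by
    apply Summable.of_norm
    simpa [norm_smul, fourier_norm] using hc
  obtain ⟨G, hG⟩ := hs
  refine ⟨G, fun x => ?_, ?_⟩
  · have := (ContinuousMap.evalCLM ℂ x).hasSum hG
    simpa [fourier_apply, toCircle_nsmul] using this
  · have h1 := (ContinuousMap.toLp (E := ℂ) 2 (haarAddCircle (T := (1:ℝ))) ℂ).hasSum hG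
    have h2 : Filter.Tendsto (fun s : Finset ℕ => ‖∑ n ∈ s, c n • fourierLp (T := (1:ℝ)) 2 (n:ℤ)‖ ^ 2)
        Filter.atTop (nhds (‖ContinuousMap.toLp (E := ℂ) 2 (haarAddCircle (T := (1:ℝ))) ℂ G‖ ^ 2)) := by
      have h3 := (Filter.Tendsto.norm h1).pow 2
      refine h3.congr fun s => ?_
      simp only [map_smul]
    refine h2.congr fun s => ?_
    have ho : Orthonormal ℂ (fun n : ℕ => fourierLp (T := (1:ℝ)) 2 (n:ℤ)) :=
      (orthonormal_fourier (T := (1:ℝ))).comp _ Nat.cast_injective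
    have h5 := ho.inner_sum c c s
    have h6 := inner_self_eq_norm_sq_to_K (𝕜 := ℂ) (∑ n ∈ s, c n • fourierLp (T := (1:ℝ)) 2 (n:ℤ))
    rw [h5] at h6
    have h7 : ((∑ n ∈ s, ‖c n‖ ^ 2 : ℝ) : ℂ)
        = ((‖∑ n ∈ s, c n • fourierLp (T := (1:ℝ)) 2 (n:ℤ)‖ ^ 2 : ℝ) : ℂ) := by
      push_cast
      rw [show ((‖∑ n ∈ s, c n • fourierLp (T := (1:ℝ)) 2 (n:ℤ)‖ : ℂ)) ^ 2 = _ from h6.symm]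
      refine Finset.sum_congr rfl fun i _ => ?_
      exact (Complex.conj_mul' _).symm
    exact (Complex.ofReal_injective h7).symm

open AddCircle in
/-- Comparison of coefficient `ℓ²` norms from a pointwise comparison on the unit circle. -/
theorem l2_compare (c d : ℕ → ℂ) (hc : Summable fun n => ‖c n‖) (hd : Summable fun n => ‖d n‖)
    (h : ∀ w : ℂ, ‖w‖ = 1 → ‖∑' n, c n * w ^ n‖ ≤ ‖∑' n, d n * w ^ n‖) :
    Summable (fun n => ‖c n‖ ^ 2) ∧ Summable (fun n => ‖d n‖ ^ 2) ∧
      ∑' n, ‖c n‖ ^ 2 ≤ ∑' n, ‖d n‖ ^ 2 := by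
  obtain ⟨G, hG, hGs⟩ := parseval_aux c hc
  obtain ⟨H, hH, hHs⟩ := parseval_aux d hd
  refine ⟨hGs.summable, hHs.summable, ?_⟩
  rw [hGs.tsum_eq, hHs.tsum_eq]
  gcongr
  apply MeasureTheory.Lp.norm_le_norm_of_ae_le
  filter_upwards [ContinuousMap.coeFn_toLp (p := 2) (𝕜 := ℂ) (haarAddCircle (T := (1:ℝ))) G,
    ContinuousMap.coeFn_toLp (p := 2) (𝕜 := ℂ) (haarAddCircle (T := (1:ℝ))) H] with x h1 h2
  rw [h1, h2, ← (hG x).tsum_eq, ← (hH x).tsum_eq]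
  exact h _ (Circle.norm_coe _)

theorem hasSum_taylorCoeff {f : ℂ → ℂ} (hf : memB f) {z : ℂ} (hz : ‖z‖ < 1) :
    HasSum (fun n => taylorCoeff f n * z ^ n) (f z) := by
  have := Complex.hasSum_taylorSeries_on_ball hf.1 (z := z) (by simpa using hz)
  refine this.congr_fun ?_
  intro n
  simp [taylorCoeff]; ring

theorem summable_taylorCoeff {f : ℂ → ℂ} (hf : memB f) {t : ℝ} (h0 : 0 ≤ t) (h1 : t < 1) :
    Summable (fun n => ‖taylorCoeff f n‖ * t ^ n) := by
  have := (hasSum_taylorCoeff hf (z := (t:ℂ)) (by simpa [abs_of_nonneg h0] using h1)).summable.norm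
  simpa [abs_of_nonneg h0] using this

theorem taylorCoeff_zero (f : ℂ → ℂ) : taylorCoeff f 0 = f 0 := by simp [taylorCoeff]

theorem norm_coeff_zero_le {f : ℂ → ℂ} (hf : memB f) : ‖taylorCoeff f 0‖ ≤ 1 := by
  rw [taylorCoeff_zero]; exact hf.2 0 (by simp)

theorem two_coeff_aux {f : ℂ → ℂ} (hf : memB f) {n : ℕ} (hn : 1 ≤ n) (y : ℂ) {t : ℝ}
    (h0 : 0 < t) (h1 : t < 1) :
    ‖taylorCoeff f 0‖ ^ 2 + (‖taylorCoeff f n + y * taylorCoeff f 0‖ * t ^ n) ^ 2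
      ≤ 1 + ‖y‖ ^ 2 := by
  set a := taylorCoeff f with ha
  have hsa := summable_taylorCoeff hf h0.le h1
  have htn : ‖(t:ℂ)‖ = t := by simp [abs_of_pos h0]
  let e : ℕ → ℂ := fun k => if n ≤ k then y * a (k - n) * t ^ k else 0
  let d : ℕ → ℂ := fun k => if k = 0 then 1 else if k = n then y * t ^ n else 0
  have hinj : Function.Injective (fun k : ℕ => k + n) := fun i j h => by simpa using h
  have hes : Summable (fun k => ‖e k‖) := by
    rw [← hinj.summable_iff]
    · have : ((fun k => ‖e k‖) ∘ fun k => k + n) = fun k => (‖y‖ * t ^ n) * (‖a k‖ * t ^ k) := by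
        funext k
        simp [e, pow_add, abs_of_pos h0]; ring
      rw [this]
      exact hsa.mul_left _
    · intro k hk
      have : ¬ n ≤ k := fun h => hk ⟨k - n, by simp; omega⟩
      simp [e, this]
  have hd0 : ∀ k ∉ ({0, n} : Finset ℕ), d k = 0 := by
    intro k hk
    simp at hk
    simp [d, hk.1, hk.2]
  have hn0 : n ≠ 0 := by omega
  have key := l2_compare (fun k => a k * t ^ k + e k) d ?_ ?_ ?_
  · obtain ⟨s1, s2, s3⟩ := key
    have hl := s1.sum_le_tsum ({0, n} : Finset ℕ) (fun _ _ => by positivity)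
    have hr : ∑' k, ‖d k‖ ^ 2 = ∑ k ∈ ({0, n} : Finset ℕ), ‖d k‖ ^ 2 :=
      tsum_eq_sum (fun k hk => by simp [hd0 k hk])
    rw [hr] at s3
    rw [Finset.sum_pair hn0.symm] at hl s3
    have e0 : e 0 = 0 := by simp [e, hn0]
    have en : e n = y * a 0 * t ^ n := by simp [e]
    have d1 : d 0 = 1 := by simp [d]
    have d2 : d n = y * t ^ n := by simp [d, hn0]
    rw [e0, en] at hl
    rw [d1, d2] at s3
    have e1 : ‖a n * (t:ℂ) ^ n + y * a 0 * t ^ n‖ = ‖a n + y * a 0‖ * t ^ n := by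
      rw [← add_mul, norm_mul, norm_pow, htn]
    rw [e1] at hl
    simp only [pow_zero, mul_one, add_zero, norm_one, one_pow, norm_mul, norm_pow, htn] at hl s3
    have : (‖y‖ * t ^ n) ^ 2 ≤ ‖y‖ ^ 2 := by
      have : t ^ n ≤ 1 := pow_le_one₀ h0.le h1.le
      have : ‖y‖ * t ^ n ≤ ‖y‖ := mul_le_of_le_one_right (norm_nonneg _) this
      gcongr
    linarith
  · refine Summable.of_nonneg_of_le (fun _ => norm_nonneg _) (fun k => norm_add_le _ _) (Summable.add ?_ hes)
    simpa [abs_of_pos h0] using hsa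
  · exact summable_of_ne_finset_zero (s := {0, n}) (fun k hk => by simp [hd0 k hk])
  · intro w hw
    have hz : ‖(t:ℂ) * w‖ < 1 := by simpa [hw, abs_of_pos h0] using h1
    have hs := hasSum_taylorCoeff hf hz
    have hs2 : HasSum (fun k => e k * w ^ k) (y * (t * w) ^ n * f (t * w)) := by
      rw [← hinj.hasSum_iff]
      · refine (hs.mul_left (y * (t * w) ^ n)).congr_fun fun k => ?_
        simp [e, mul_pow, pow_add, ha]; ring
      · intro k hk
        have : ¬ n ≤ k := fun h => hk ⟨k - n, by simp; omega⟩
        simp [e, this]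
    have hs3 : HasSum (fun k => (a k * t ^ k + e k) * w ^ k) (f (t * w) + y * (t * w) ^ n * f (t * w)) := by
      refine (hs.add hs2).congr_fun fun k => ?_
      simp [mul_pow, ha]; ring
    have hd : ∑' k, d k * w ^ k = 1 + y * (t * w) ^ n := by
      rw [tsum_eq_sum (s := ({0, n} : Finset ℕ)) (fun k hk => by simp [hd0 k hk]),
        Finset.sum_pair hn0.symm]
      simp [d, hn0, mul_pow]; ring
    rw [hs3.tsum_eq, hd, show f (t * w) + y * (t * w) ^ n * f (t * w)
      = (1 + y * (t * w) ^ n) * f (t * w) by ring, norm_mul]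
    exact mul_le_of_le_one_right (norm_nonneg _) (hf.2 _ (by simpa using hz))

theorem two_coeff {f : ℂ → ℂ} (hf : memB f) {n : ℕ} (hn : 1 ≤ n) (y : ℂ) :
    ‖taylorCoeff f 0‖ ^ 2 + ‖taylorCoeff f n + y * taylorCoeff f 0‖ ^ 2 ≤ 1 + ‖y‖ ^ 2 := by
  have hc : Continuous (fun t : ℝ => ‖taylorCoeff f 0‖ ^ 2 +
    (‖taylorCoeff f n + y * taylorCoeff f 0‖ * t ^ n) ^ 2) := by fun_prop
  have ht := (hc.tendsto 1).mono_left (nhdsWithin_le_nhds (s := Set.Iio 1))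
  have := le_of_tendsto ht (b := 1 + ‖y‖ ^ 2) (by
    filter_upwards [Ioo_mem_nhdsLT (show (0:ℝ) < 1 by norm_num)] with t ht
    exact two_coeff_aux hf hn y ht.1 ht.2)
  simpa using this

theorem coeff_le {f : ℂ → ℂ} (hf : memB f) {n : ℕ} (hn : 1 ≤ n) :
    ‖taylorCoeff f n‖ ≤ 1 - ‖taylorCoeff f 0‖ ^ 2 := by
  have ha := norm_coeff_zero_le hf
  set a := taylorCoeff f 0 with hadef
  set b := taylorCoeff f n with hb
  by_cases hb0 : b = 0
  · rw [hb0, norm_zero]; nlinarith [norm_nonneg a]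
  have hbn : (‖b‖ : ℂ) ≠ 0 := by simpa using hb0
  have h := two_coeff hf hn ((starRingEnd ℂ) a * (b / ‖b‖))
  rw [← hadef, ← hb] at h
  have h1 : b + (starRingEnd ℂ) a * (b / ‖b‖) * a = (b / ‖b‖) * ((‖b‖ + ‖a‖ ^ 2 : ℝ) : ℂ) := by
    have := Complex.conj_mul' a
    push_cast
    rw [← this]
    field_simp
  have h2 : ‖b / (‖b‖ : ℂ)‖ = 1 := by simp [hb0]
  rw [h1, norm_mul, norm_mul, h2, Complex.norm_real, RCLike.norm_conj] at h
  have h3 : ‖(‖b‖ + ‖a‖ ^ 2)‖ = ‖b‖ + ‖a‖ ^ 2 := by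
    rw [Real.norm_eq_abs, abs_of_nonneg (by positivity)]
  rw [h3] at h
  nlinarith [norm_nonneg a, norm_nonneg b]

theorem schwarz_pick {f : ℂ → ℂ} (hf : memB f) (h : ‖f 0‖ < 1) {z : ℂ} (hz : ‖z‖ < 1) :
    ‖f z - f 0‖ ≤ ‖z‖ * ‖1 - (starRingEnd ℂ) (f 0) * f z‖ := by
  have hne : ∀ z ∈ ball (0:ℂ) 1, 1 - (starRingEnd ℂ) (f 0) * f z ≠ 0 := by
    intro z hz h0
    have h1 : (starRingEnd ℂ) (f 0) * f z = 1 := (sub_eq_zero.mp h0).symm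
    have h2 : ‖f 0‖ * ‖f z‖ = 1 := by rw [← RCLike.norm_conj, ← norm_mul, h1, norm_one]
    nlinarith [hf.2 z hz, norm_nonneg (f 0), norm_nonneg (f z)]
  have key := Complex.norm_le_norm_of_mapsTo_ball
    (f := fun z => (f z - f 0) / (1 - (starRingEnd ℂ) (f 0) * f z)) (R := 1) (z := z) ?_ ?_ ?_ hz
  · have hm : z ∈ ball (0:ℂ) 1 := by simpa using hz
    rw [norm_div, div_le_iff₀ (norm_pos_iff.mpr (hne z hm))] at key
    exact key
  · exact (hf.1.sub_const _).div ((differentiableOn_const _).sub (hf.1.const_mul _)) hne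
  · intro z hz
    rw [mem_closedBall_zero_iff, norm_div, div_le_one (norm_pos_iff.mpr (hne z hz))]
    have hb := hf.2 z hz
    apply le_of_sq_le_sq _ (norm_nonneg _)
    rw [← Complex.normSq_eq_norm_sq, ← Complex.normSq_eq_norm_sq]
    have e1 : ‖f 0‖ ^ 2 < 1 := by nlinarith [norm_nonneg (f 0)]
    have e2 : ‖f z‖ ^ 2 ≤ 1 := by nlinarith [norm_nonneg (f z)]
    rw [← Complex.normSq_eq_norm_sq] at e1 e2
    simp [Complex.normSq_apply] at *
    nlinarith
  · simp

theorem area_bound {f : ℂ → ℂ} (hf : memB f) (h : ‖taylorCoeff f 0‖ < 1) {t : ℝ}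
    (h0 : 0 < t) (h1 : t < 1) :
    Summable (fun n => (‖taylorCoeff f (n + 1)‖ * t ^ (n + 1)) ^ 2) ∧
    ∑' n, (‖taylorCoeff f (n + 1)‖ * t ^ (n + 1)) ^ 2
      ≤ t ^ 2 * ((1 - ‖taylorCoeff f 0‖ ^ 2) ^ 2 + ‖taylorCoeff f 0‖ ^ 2 *
        ∑' n, (‖taylorCoeff f (n + 1)‖ * t ^ (n + 1)) ^ 2) := by
  set a := taylorCoeff f with ha
  have hsa := summable_taylorCoeff hf h0.le h1
  rw [← ha] at hsa
  have haf : f 0 = a 0 := (taylorCoeff_zero f).symm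
  let c : ℕ → ℂ := fun n => if n = 0 then 0 else a n * t ^ n
  let d : ℕ → ℂ := fun n => t * ((if n = 0 then 1 else 0) - (starRingEnd ℂ) (a 0) * (a n * t ^ n))
  have hcn : ∀ n, ‖c (n + 1)‖ = ‖a (n+1)‖ * t ^ (n+1) := fun n => by simp [c, abs_of_pos h0]
  have hdn : ∀ n, ‖d (n + 1)‖ = t * ‖a 0‖ * (‖a (n+1)‖ * t ^ (n+1)) := fun n => by
    simp [d, abs_of_pos h0]; ring
  have hd0 : ‖d 0‖ = t * (1 - ‖a 0‖ ^ 2) := by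
    have : (d 0) = ((t * (1 - ‖a 0‖ ^ 2) : ℝ) : ℂ) := by
      simp [d, Complex.conj_mul']
    rw [this, Complex.norm_real, Real.norm_eq_abs, abs_of_nonneg]
    have : ‖a 0‖ ^ 2 ≤ 1 := by nlinarith [norm_nonneg (a 0)]
    exact mul_nonneg h0.le (by linarith)
  have hsc : Summable (fun n => ‖c n‖) := by
    rw [← summable_nat_add_iff 1]
    simp only [hcn]
    exact (summable_nat_add_iff 1).mpr hsa
  have hsd : Summable (fun n => ‖d n‖) := by
    rw [← summable_nat_add_iff 1]
    simp only [hdn]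
    exact ((summable_nat_add_iff 1).mpr hsa).mul_left _
  have hcmp : ∀ w : ℂ, ‖w‖ = 1 → ‖∑' n, c n * w ^ n‖ ≤ ‖∑' n, d n * w ^ n‖ := by
    intro w hw
    have hz : ‖(t:ℂ) * w‖ < 1 := by simpa [hw, abs_of_pos h0] using h1
    have hs := hasSum_taylorCoeff hf hz
    have hp : HasSum (fun n : ℕ => if n = 0 then (1:ℂ) else 0) 1 := hasSum_ite_eq 0 1
    have hc : HasSum (fun n => c n * w ^ n) (f (t * w) - f 0) := by
      refine (hs.sub (hp.mul_left (f 0))).congr_fun ?_ |> fun h => by simpa using h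
      intro n
      by_cases hn : n = 0
      · simp [c, hn, haf, ha]
      · simp [c, hn, mul_pow, ha]; ring
    have hd : HasSum (fun n => d n * w ^ n) (t * (1 - (starRingEnd ℂ) (f 0) * f (t * w))) := by
      refine ((hp.sub (hs.mul_left ((starRingEnd ℂ) (f 0)))).mul_left (t:ℂ)).congr_fun fun n => ?_
      by_cases hn : n = 0
      · simp [d, hn, haf, ha]
      · simp [d, hn, mul_pow, haf, ha]; ring
    rw [hc.tsum_eq, hd.tsum_eq, norm_mul]
    have := schwarz_pick hf (by rwa [haf]) hz
    simpa [hw] using this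
  obtain ⟨s1, s2, s3⟩ := l2_compare c d hsc hsd hcmp
  rw [s1.tsum_eq_zero_add, s2.tsum_eq_zero_add] at s3
  simp only [hcn, hdn, hd0] at s3
  have hs := (summable_nat_add_iff 1).mpr s1
  simp only [hcn] at hs
  refine ⟨hs, ?_⟩
  have e : ∀ n, (t * ‖a 0‖ * (‖a (n+1)‖ * t ^ (n+1))) ^ 2
    = (t ^ 2 * ‖a 0‖ ^ 2) * (‖a (n+1)‖ * t ^ (n+1)) ^ 2 := fun n => by ring
  simp only [e, tsum_mul_left] at s3
  have : c 0 = 0 := by simp [c]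
  rw [this, norm_zero] at s3
  nlinarith

theorem bombieri {f : ℂ → ℂ} (hf : memB f) (h : ‖taylorCoeff f 0‖ < 1)
    (h3 : 1 / 3 < ‖taylorCoeff f 0‖) :
    ∑' n, ‖taylorCoeff f (n + 1)‖ * (1 / 3 : ℝ) ^ (n + 1)
      ≤ (1 - ‖taylorCoeff f 0‖ ^ 2) / (3 - ‖taylorCoeff f 0‖) := by
  have hS := (summable_nat_add_iff 1).mpr
    (summable_taylorCoeff hf (t := 1 / 3) (by norm_num) (by norm_num))
  set a := ‖taylorCoeff f 0‖ with ha
  set t := Real.sqrt (1 / (3 * a)) with ht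
  have hapos : 0 < a := by linarith
  have ht2 : t ^ 2 = 1 / (3 * a) := Real.sq_sqrt (by positivity)
  have htpos : 0 < t := Real.sqrt_pos.mpr (by positivity)
  have ht1 : t < 1 := by
    have : t ^ 2 < 1 := by rw [ht2, div_lt_one (by positivity)]; linarith
    nlinarith
  obtain ⟨hs, hX⟩ := area_bound hf h htpos ht1
  rw [← ha] at hX
  set X := ∑' n, (‖taylorCoeff f (n + 1)‖ * t ^ (n + 1)) ^ 2 with hXdef
  have hb : 0 < 1 - a ^ 2 := by nlinarith
  have hg : HasSum (fun n : ℕ => (a / 3) ^ (n + 1)) (a / (3 - a)) := by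
    have := (hasSum_geometric_of_lt_one (r := a / 3) (by positivity) (by linarith)).mul_left (a / 3)
    convert! this using 1
    · funext n; ring
    · have : 3 - a ≠ 0 := by linarith
      have : 1 - a / 3 ≠ 0 := by intro h; apply this; linarith
      field_simp
  have hXle : X ≤ (1 - a ^ 2) ^ 2 / (a * (3 - a)) := by
    rw [le_div_iff₀ (by nlinarith)]
    rw [ht2] at hX
    have : 1 / (3 * a) * ((1 - a ^ 2) ^ 2 + a ^ 2 * X) * (3 * a) = (1 - a ^ 2) ^ 2 + a ^ 2 * X := by
      field_simp
    have h2 : X * (3 * a) ≤ (1 - a ^ 2) ^ 2 + a ^ 2 * X := by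
      rw [← this]; gcongr
    linarith
  set μ := a / (1 - a ^ 2) with hμ
  have hμpos : 0 < μ := by positivity
  have hterm : ∀ n, ‖taylorCoeff f (n + 1)‖ * (1 / 3 : ℝ) ^ (n + 1)
      ≤ μ / 2 * (‖taylorCoeff f (n + 1)‖ * t ^ (n + 1)) ^ 2 + 1 / (2 * μ) * (a / 3) ^ (n + 1) := by
    intro n
    have e1 : (1 / 3 : ℝ) ^ (n + 1) = t ^ (n + 1) * (t * a) ^ (n + 1) := by
      rw [← mul_pow]; congr 1
      rw [← mul_assoc, ← sq, ht2]; field_simp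
    have e2 : (a / 3) ^ (n + 1) = ((t * a) ^ (n + 1)) ^ 2 := by
      rw [← pow_mul, mul_comm (n + 1) 2, pow_mul]; congr 1
      rw [mul_pow, ht2]; field_simp
    rw [e1, e2, ← mul_assoc]
    set U := ‖taylorCoeff f (n + 1)‖ * t ^ (n + 1)
    set V := (t * a) ^ (n + 1)
    have : μ / 2 * U ^ 2 + 1 / (2 * μ) * V ^ 2 - U * V = 1 / (2 * μ) * (μ * U - V) ^ 2 := by
      field_simp; ring
    have h2 : 0 ≤ 1 / (2 * μ) * (μ * U - V) ^ 2 := by positivity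
    linarith
  have hle := hS.tsum_le_tsum hterm ((hs.mul_left _).add (hg.summable.mul_left _))
  rw [(hs.mul_left _).tsum_add (hg.summable.mul_left _), tsum_mul_left, tsum_mul_left,
    hg.tsum_eq, ← hXdef] at hle
  have h5 : μ / 2 * X ≤ μ / 2 * ((1 - a ^ 2) ^ 2 / (a * (3 - a))) := by gcongr
  have h6 : μ / 2 * ((1 - a ^ 2) ^ 2 / (a * (3 - a))) + 1 / (2 * μ) * (a / (3 - a))
      = (1 - a ^ 2) / (3 - a) := by
    rw [hμ]
    have : 3 - a ≠ 0 := by linarith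
    field_simp
    ring
  linarith

theorem trivial_bound {f : ℂ → ℂ} (hf : memB f) :
    ∑' n, ‖taylorCoeff f (n + 1)‖ * (1 / 3 : ℝ) ^ (n + 1)
      ≤ (1 - ‖taylorCoeff f 0‖ ^ 2) / 2 := by
  have hS := (summable_nat_add_iff 1).mpr
    (summable_taylorCoeff hf (t := 1 / 3) (by norm_num) (by norm_num))
  have hg : HasSum (fun n : ℕ => (1 - ‖taylorCoeff f 0‖ ^ 2) * (1 / 3 : ℝ) ^ (n + 1))
      ((1 - ‖taylorCoeff f 0‖ ^ 2) / 2) := by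
    have := (hasSum_geometric_of_lt_one (r := (1 / 3 : ℝ)) (by norm_num) (by norm_num)).mul_left
      ((1 - ‖taylorCoeff f 0‖ ^ 2) * (1 / 3))
    convert! this using 1
    · funext n; ring
    · norm_num; ring
  rw [← hg.tsum_eq]
  refine hS.tsum_le_tsum (fun n => ?_) hg.summable
  have := coeff_le hf (n := n + 1) (by omega)
  gcongr

theorem area_le {f : ℂ → ℂ} (hf : memB f) {r : ℝ} (h0 : 0 ≤ r) (h1 : r ≤ 1 / 3) :
    0 ≤ ∑' n : ℕ, (n : ℝ) * ‖taylorCoeff f n‖ ^ 2 * r ^ (2 * n) ∧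
    ∑' n : ℕ, (n : ℝ) * ‖taylorCoeff f n‖ ^ 2 * r ^ (2 * n)
      ≤ 9 / 64 * (1 - ‖taylorCoeff f 0‖ ^ 2) ^ 2 := by
  refine ⟨tsum_nonneg fun n => by positivity, ?_⟩
  have hg : HasSum (fun n : ℕ => (1 - ‖taylorCoeff f 0‖ ^ 2) ^ 2 * ((n:ℝ) * (1 / 9 : ℝ) ^ n))
      (9 / 64 * (1 - ‖taylorCoeff f 0‖ ^ 2) ^ 2) := by
    have := (hasSum_coe_mul_geometric_of_norm_lt_one (r := (1 / 9 : ℝ)) (by norm_num)).mul_left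
      ((1 - ‖taylorCoeff f 0‖ ^ 2) ^ 2)
    convert! this using 1
    norm_num; ring
  have hle : ∀ n : ℕ, (n : ℝ) * ‖taylorCoeff f n‖ ^ 2 * r ^ (2 * n)
      ≤ (1 - ‖taylorCoeff f 0‖ ^ 2) ^ 2 * ((n:ℝ) * (1 / 9 : ℝ) ^ n) := by
    intro n
    rcases Nat.eq_zero_or_pos n with rfl | hn
    · simp
    have h2 := coeff_le hf (n := n) hn
    have h3 : r ^ (2 * n) ≤ (1 / 9 : ℝ) ^ n := by
      rw [pow_mul]; gcongr; nlinarith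
    calc (n : ℝ) * ‖taylorCoeff f n‖ ^ 2 * r ^ (2 * n)
        ≤ (n : ℝ) * (1 - ‖taylorCoeff f 0‖ ^ 2) ^ 2 * (1 / 9 : ℝ) ^ n := by gcongr
      _ = _ := by ring
  rw [← hg.tsum_eq]
  exact (Summable.of_nonneg_of_le (fun n => by positivity) hle hg.summable).tsum_le_tsum hle
    hg.summable

theorem lower {f : ℂ → ℂ} (hf : memB f) {r : ℝ} (h0 : 0 ≤ r) (h1 : r ≤ 1 / 3) :
    bohrSum f r + 16 / 9 * phi0 f r ≤ 1 := by
  have ha1 := norm_coeff_zero_le hf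
  obtain ⟨hs0, hs1⟩ := area_le hf h0 h1
  have hA1 := trivial_bound hf
  have hS3 := summable_taylorCoeff hf (t := 1 / 3) (by norm_num) (by norm_num)
  have hSr := summable_taylorCoeff hf (t := r) h0 (by linarith)
  have hbs : bohrSum f r ≤ ‖taylorCoeff f 0‖
      + ∑' n, ‖taylorCoeff f (n + 1)‖ * (1 / 3 : ℝ) ^ (n + 1) := by
    have : bohrSum f r ≤ ∑' n, ‖taylorCoeff f n‖ * (1 / 3 : ℝ) ^ n :=
      hSr.tsum_le_tsum (fun n => by gcongr) hS3
    rw [hS3.tsum_eq_zero_add] at this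
    simpa using this
  have hB := bombieri hf
  have ha0 := norm_nonneg (taylorCoeff f 0)
  have hphi : phi0 f r = (∑' n : ℕ, (n : ℝ) * ‖taylorCoeff f n‖ ^ 2 * r ^ (2 * n)) /
      (1 - ∑' n : ℕ, (n : ℝ) * ‖taylorCoeff f n‖ ^ 2 * r ^ (2 * n)) := by
    unfold phi0 Sarea
    rw [← mul_one_sub, mul_div_mul_left _ _ Real.pi_ne_zero]
  rw [hphi]
  generalize (∑' n : ℕ, (n : ℝ) * ‖taylorCoeff f n‖ ^ 2 * r ^ (2 * n)) = S at *
  generalize (∑' n, ‖taylorCoeff f (n + 1)‖ * (1 / 3 : ℝ) ^ (n + 1)) = A at *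
  generalize ‖taylorCoeff f 0‖ = a at *
  set s := 9 / 64 * (1 - a ^ 2) ^ 2 with hs
  have hq : 0 ≤ 1 - a ^ 2 := by nlinarith
  have hsl : s ≤ 9 / 64 := by
    have : (1 - a ^ 2) ^ 2 ≤ 1 := by nlinarith
    linarith
  have hSs : S / (1 - S) ≤ s / (1 - s) := by
    rw [div_le_div_iff₀ (by linarith) (by linarith)]; nlinarith
  have goal2 : A + 16 / 9 * (s / (1 - s)) ≤ 1 - a := by
    have e : 16 / 9 * (s / (1 - s)) = (1 - a ^ 2) ^ 2 / 4 / (1 - s) := by rw [hs]; ring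
    rw [e]
    rcases le_or_gt a (1 / 3) with h | h
    · have : (1 - a ^ 2) ^ 2 / 4 / (1 - s) ≤ (1 - a) ^ 2 / 2 := by
        rw [div_le_iff₀ (by linarith)]
        have h7 : (1 + a) ^ 2 ≤ 2 * (1 - s) := by
          have : (1 - a ^ 2) ^ 2 ≤ 1 - a ^ 2 * (17 / 9) := by
            nlinarith [mul_nonneg (sq_nonneg a) (show 0 ≤ 1 / 9 - a ^ 2 by nlinarith)]
          rw [hs]
          nlinarith
        have := mul_le_mul_of_nonneg_left h7 (sq_nonneg (1 - a))
        nlinarith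
      nlinarith
    · rcases ha1.lt_or_eq with h' | h'
      · have hA := hB h' h
        have h3 : 0 < 3 - a := by linarith
        have : (1 - a ^ 2) ^ 2 / 4 / (1 - s) ≤ 2 * (1 - a) ^ 2 / (3 - a) := by
          rw [div_le_div_iff₀ (by linarith) h3]
          have h7 : (1 + a) ^ 2 * (3 - a) ≤ 8 * (1 - s) := by
            rw [hs]
            have e8 : 8 * (1 - 9 / 64 * (1 - a ^ 2) ^ 2) - (1 + a) ^ 2 * (3 - a)
              = (1 - a) * ((5 - a ^ 2) - 9 / 8 * (1 - a) * (1 + a) ^ 2) := by ring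
            have : 0 ≤ (5 - a ^ 2) - 9 / 8 * (1 - a) * (1 + a) ^ 2 := by nlinarith
            nlinarith [mul_nonneg (sub_nonneg.mpr ha1) this]
          have := mul_le_mul_of_nonneg_left h7 (sq_nonneg (1 - a))
          nlinarith
        have e9 : (1 - a ^ 2) / (3 - a) + 2 * (1 - a) ^ 2 / (3 - a) = 1 - a := by
          field_simp; ring
        linarith
      · subst h'
        norm_num at hA1 ⊢
        linarith
  linarith

theorem taylorCoeff_unique {f : ℂ → ℂ} {c : ℕ → ℂ}
    (h : ∀ z : ℂ, ‖z‖ < 1 → HasSum (fun n => c n * z ^ n) (f z)) (n : ℕ) :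
    taylorCoeff f n = c n := by
  have h1 : HasFPowerSeriesAt f (FormalMultilinearSeries.ofScalars ℂ c) 0 := by
    rw [hasFPowerSeriesAt_iff']
    filter_upwards [ball_mem_nhds (0:ℂ) (show (0:ℝ) < 1 by norm_num)] with z hz
    refine (h z (by simpa using hz)).congr_fun fun n => ?_
    simp [FormalMultilinearSeries.coeff_ofScalars, mul_comm]
  have h2 := h1.analyticAt.hasFPowerSeriesAt
  have h3 := h2.eq_formalMultilinearSeries h1
  have h4 := congrArg (fun p => FormalMultilinearSeries.coeff p n) h3
  simp only [FormalMultilinearSeries.coeff_ofScalars] at h4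
  exact h4

theorem upper {l a : ℝ} (ha0 : 0 < a) (ha1 : a < 1)
    (hl : ∀ f, memB f → ∀ r, 0 ≤ r → r ≤ 1 / 3 → bohrSum f r + l * phi0 f r ≤ 1) :
    l ≤ 16 / 9 * ((9 - a ^ 4) / ((1 + a) ^ 2 * (3 - a))) := by
  let f : ℂ → ℂ := fun z => (a - z) / (1 - a * z)
  have hne : ∀ z : ℂ, ‖z‖ < 1 → 1 - (a:ℂ) * z ≠ 0 := by
    intro z hz h0
    have h1 : (a:ℂ) * z = 1 := (sub_eq_zero.mp h0).symm
    have h2 : a * ‖z‖ = 1 := by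
      have := congrArg norm h1
      simpa [abs_of_pos ha0] using this
    nlinarith [norm_nonneg z]
  have hf : memB f := by
    constructor
    · refine DifferentiableOn.div (by fun_prop) (by fun_prop) ?_
      intro z hz
      exact hne z (by simpa using hz)
    · intro z hz
      have hz' : ‖z‖ < 1 := by simpa using hz
      simp only [f]
      rw [norm_div, div_le_one (norm_pos_iff.mpr (hne z hz'))]
      apply le_of_sq_le_sq _ (norm_nonneg _)
      rw [← Complex.normSq_eq_norm_sq, ← Complex.normSq_eq_norm_sq]
      have e2 : ‖z‖ ^ 2 ≤ 1 := by nlinarith [norm_nonneg z]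
      have e1 : a ^ 2 ≤ 1 := by nlinarith
      rw [← Complex.normSq_eq_norm_sq] at e2
      clear hl
      simp only [Complex.normSq_apply, Complex.sub_re, Complex.sub_im, Complex.mul_re, Complex.mul_im,
        Complex.ofReal_re, Complex.ofReal_im, Complex.one_re, Complex.one_im] at e2 ⊢
      nlinarith [mul_nonneg (sub_nonneg.mpr e1) (sub_nonneg.mpr e2)]
  let c : ℕ → ℂ := fun n => if n = 0 then (a:ℂ) else -(1 - (a:ℂ) ^ 2) * (a:ℂ) ^ (n - 1)
  have hc : ∀ n, taylorCoeff f n = c n := by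
    apply taylorCoeff_unique
    intro z hz
    have hg : HasSum (fun n : ℕ => ((a:ℂ) * z) ^ n) (1 - (a:ℂ) * z)⁻¹ := by
      apply hasSum_geometric_of_norm_lt_one
      rw [norm_mul, Complex.norm_real, Real.norm_eq_abs, abs_of_pos ha0]
      nlinarith [norm_nonneg z]
    have h1 : HasSum (fun n => c (n + 1) * z ^ (n + 1)) (f z - a) := by
      have := hg.mul_left (-(1 - (a:ℂ) ^ 2) * z)
      convert! this using 1
      · funext n; simp [c, mul_pow, pow_succ]; ring
      · have := hne z hz
        simp only [f]
        field_simp; ring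
    have h2 := (hasSum_nat_add_iff' (f := fun n => c n * z ^ n) (g := f z) 1)
    apply h2.mp
    simpa [c] using h1
  have hb : 0 < 1 - a ^ 2 := by nlinarith
  have hn0 : ‖taylorCoeff f 0‖ = a := by rw [hc]; simp [c, abs_of_pos ha0]
  have hn : ∀ n, ‖taylorCoeff f (n + 1)‖ = (1 - a ^ 2) * a ^ n := by
    intro n
    rw [hc]
    have : c (n + 1) = ((-((1 - a ^ 2) * a ^ n) : ℝ) : ℂ) := by simp [c]; ring
    rw [this, Complex.norm_real, norm_neg, Real.norm_eq_abs, abs_of_pos (by positivity)]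
  have h3 : 0 < 3 - a := by linarith
  have h3' : 0 < 9 - a ^ 2 := by nlinarith
  have hbohr : bohrSum f (1 / 3) = a + (1 - a ^ 2) / (3 - a) := by
    unfold bohrSum
    rw [(summable_taylorCoeff hf (t := 1 / 3) (by norm_num) (by norm_num)).tsum_eq_zero_add]
    have hg := (hasSum_geometric_of_lt_one (r := a / 3) (by positivity) (by linarith)).mul_left
      ((1 - a ^ 2) / 3)
    have : ∀ n : ℕ, ‖taylorCoeff f (n + 1)‖ * (1 / 3 : ℝ) ^ (n + 1)
        = (1 - a ^ 2) / 3 * (a / 3) ^ n := by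
      intro n; rw [hn, div_pow, div_pow, one_pow, pow_succ]; field_simp; try ring
    simp only [this]
    rw [hg.tsum_eq, hn0]
    have : 1 - a / 3 = (3 - a) / 3 := by ring
    rw [this]
    field_simp
  have hS : ∑' n : ℕ, (n : ℝ) * ‖taylorCoeff f n‖ ^ 2 * (1 / 3 : ℝ) ^ (2 * n)
      = 9 * (1 - a ^ 2) ^ 2 / (9 - a ^ 2) ^ 2 := by
    have hlt : ‖a ^ 2 / 9‖ < 1 := by
      rw [Real.norm_eq_abs, abs_of_pos (by positivity)]; linarith
    have hg : HasSum (fun n : ℕ => (1 - a ^ 2) ^ 2 / a ^ 2 * ((n:ℝ) * (a ^ 2 / 9) ^ n))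
        ((1 - a ^ 2) ^ 2 / a ^ 2 * (a ^ 2 / 9 / (1 - a ^ 2 / 9) ^ 2)) :=
      (hasSum_coe_mul_geometric_of_norm_lt_one hlt).mul_left _
    have : ∀ n : ℕ, (n : ℝ) * ‖taylorCoeff f n‖ ^ 2 * (1 / 3 : ℝ) ^ (2 * n)
        = (1 - a ^ 2) ^ 2 / a ^ 2 * (n * (a ^ 2 / 9) ^ n) := by
      intro n
      rcases n with _ | n
      · simp
      · rw [hn, pow_mul, div_pow (a ^ 2), ← pow_mul a, one_div_pow, one_div_pow]
        norm_num
        field_simp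
        ring
    simp only [this]
    rw [hg.tsum_eq]
    have : 1 - a ^ 2 / 9 = (9 - a ^ 2) / 9 := by ring
    rw [this]
    field_simp
    try norm_num
  have h9 : 0 < 9 - a ^ 4 := by nlinarith [sq_nonneg a]
  have hphi : phi0 f (1 / 3) = 9 * (1 - a ^ 2) ^ 2 / (8 * (9 - a ^ 4)) := by
    unfold phi0 Sarea
    rw [hS, ← mul_one_sub, mul_div_mul_left _ _ Real.pi_ne_zero]
    have : 1 - 9 * (1 - a ^ 2) ^ 2 / (9 - a ^ 2) ^ 2 = 8 * (9 - a ^ 4) / (9 - a ^ 2) ^ 2 := by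
      field_simp; ring
    rw [this]
    field_simp
  have h := hl f hf (1 / 3) (by norm_num) le_rfl
  rw [hbohr, hphi] at h
  have e1 : 1 - (a + (1 - a ^ 2) / (3 - a)) = 2 * (1 - a) ^ 2 / (3 - a) := by
    field_simp; ring
  have h5 : l * (9 * (1 - a ^ 2) ^ 2 / (8 * (9 - a ^ 4))) ≤ 2 * (1 - a) ^ 2 / (3 - a) := by linarith
  have h6 : 0 < 9 * (1 - a ^ 2) ^ 2 / (8 * (9 - a ^ 4)) := by positivity
  rw [← le_div_iff₀ h6] at h5
  refine h5.trans (le_of_eq ?_)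
  have h7 : 1 - a ≠ 0 := by linarith
  have h8 : 1 - a ^ 2 = (1 - a) * (1 + a) := by ring
  have h10 : 1 + a ≠ 0 := by linarith
  rw [h8]
  field_simp
  try norm_num

theorem tendsto_aux : Filter.Tendsto
    (fun a : ℝ => 16 / 9 * ((9 - a ^ 4) / ((1 + a) ^ 2 * (3 - a))))
    (nhdsWithin 1 (Set.Iio 1)) (nhds (16 / 9)) := by
  have : ContinuousAt (fun a : ℝ => 16 / 9 * ((9 - a ^ 4) / ((1 + a) ^ 2 * (3 - a)))) 1 := by
    refine ContinuousAt.mul (by fun_prop) (ContinuousAt.div (by fun_prop) (by fun_prop) ?_)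
    norm_num
  have h := this.tendsto.mono_left (nhdsWithin_le_nhds (s := Set.Iio 1))
  norm_num at h ⊢
  exact h

/-- The constant `16/9` is sharp at radius `1/3`:
`inf_{0 ≤ a < 1} (16/9)(9−a⁴)/((1+a)²(3−a)) = 16/9`, i.e. the sharp constant
`Λ_{φ₀}(1/3)` equals `16/9`. -/
theorem sharpConstant_at_one_third :
    sInf {x : ℝ | ∃ a : ℝ, 0 ≤ a ∧ a < 1 ∧
        x = 16 / 9 * ((9 - a ^ 4) / ((1 + a) ^ 2 * (3 - a)))} = 16 / 9 ∧
    sharpConstant phi0 (1 / 3) = 16 / 9 := by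
  constructor
  · apply IsGLB.csInf_eq
    · constructor
      · rintro x ⟨a, h0, h1, rfl⟩
        have : 1 ≤ (9 - a ^ 4) / ((1 + a) ^ 2 * (3 - a)) := by
          have h3 : 0 < 3 - a := by linarith
          rw [le_div_iff₀ (by positivity)]
          have h4 : 9 - a ^ 4 - (1 + a) ^ 2 * (3 - a) = (1 - a) * (6 + a + a ^ 3) := by ring
          have : 0 ≤ (1 - a) * (6 + a + a ^ 3) := mul_nonneg (by linarith) (by positivity)
          linarith
        linarith
      · intro b hb
        refine ge_of_tendsto tendsto_aux ?_
        filter_upwards [Ioo_mem_nhdsLT (show (0:ℝ) < 1 by norm_num)] with t ht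
        exact hb ⟨t, ht.1.le, ht.2, rfl⟩
    · exact ⟨_, 0, le_rfl, by norm_num, rfl⟩
  · apply IsGreatest.csSup_eq
    constructor
    · exact ⟨by norm_num, fun f hf r h0 h1 => lower hf h0 h1⟩
    · rintro l ⟨_, hl⟩
      refine ge_of_tendsto tendsto_aux ?_
      filter_upwards [Ioo_mem_nhdsLT (show (0:ℝ) < 1 by norm_num)] with t ht
      exact upper ht.1 ht.2 hl
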